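/- Let W be a finite group of linear transformations of ℂ^ℓ preserving an inner product, and let A be a finite-dimensional graded quotient of the polynomial representation of the rational Cherednik algebra H_{1,c}(W) by a submodule J ⊆ ℂ[h]. If A is an irreducible H_{1,c}-module, then the top nonzero graded component of A is one-dimensional and the multiplication pairing A[m] × A[d − m] → A[d] is nondegenerate for all m (i.e. A is a graded Frobenius algebra). -/

import Mathlib

noncomputable section
open MvPolynomial
open scoped Matrix Classical

/-- The general linear group of `ℂ^ℓ`. -/
abbrev GLC (ℓ : ℕ) := Matrix.GeneralLinearGroup (Fin ℓ) ℂ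

/-- The matrix of an element of a subgroup `W ⊆ GL(ℂ^ℓ)`. -/
def matOf {ℓ : ℕ} {W : Subgroup (GLC ℓ)} (g : W) : Matrix (Fin ℓ) (Fin ℓ) ℂ :=
  ((g : GLC ℓ) : Matrix (Fin ℓ) (Fin ℓ) ℂ)

/-- The action of `g ∈ W` on polynomials: `(g · f)(v) = f(g⁻¹ v)`. -/
def polyAct {ℓ : ℕ} {W : Subgroup (GLC ℓ)} (g : W) :
    MvPolynomial (Fin ℓ) ℂ →ₐ[ℂ] MvPolynomial (Fin ℓ) ℂ :=
  aeval (fun i => ∑ j : Fin ℓ, C (matOf g⁻¹ i j) * X j)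

/-- The quotient of `b` by `a` when `a ∣ b`, and `0` otherwise. -/
def divOr0 {ℓ : ℕ} (a b : MvPolynomial (Fin ℓ) ℂ) : MvPolynomial (Fin ℓ) ℂ :=
  if h : a ∣ b then h.choose else 0

/-- The Dunkl operator
`D_y = ∂_y - Σ_{s ∈ S} (2 c_s/(1 - λ_s)) (α_s, y)/α_s (1 - s)` of the rational Cherednik
algebra `H_{1,c}(W,h)` in its polynomial representation `ℂ[h]`, where `al s` is the root
`α_s` and `lam s` the nontrivial eigenvalue `λ_s` of the complex reflection `s` on `h*`. -/
def dunklC {ℓ : ℕ} {W : Subgroup (GLC ℓ)} (S : Finset W) (al : W → Fin ℓ → ℂ)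
    (lam c : W → ℂ) (y : Fin ℓ → ℂ) (f : MvPolynomial (Fin ℓ) ℂ) :
    MvPolynomial (Fin ℓ) ℂ :=
  (∑ i : Fin ℓ, y i • pderiv i f)
    - ∑ s ∈ S, (2 * c s / (1 - lam s) * ∑ i : Fin ℓ, al s i * y i)
        • divOr0 (∑ i : Fin ℓ, C (al s i) * X i) (f - polyAct s f)


/-- The polynomial ring `ℂ[h]`. -/
abbrev PolyR (ℓ : ℕ) := MvPolynomial (Fin ℓ) ℂ

/-- The linear form attached to a vector. -/
def linForm {ℓ : ℕ} (a : Fin ℓ → ℂ) : PolyR ℓ := ∑ i : Fin ℓ, C (a i) * X i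

/-- The Euler derivation. -/
def eu (ℓ : ℕ) : Derivation ℂ (PolyR ℓ) (PolyR ℓ) := mkDerivation ℂ X

/-- The sum of squares of the coordinates. -/
def sqSum (ℓ : ℕ) : PolyR ℓ := ∑ i : Fin ℓ, X i ^ 2

/-- Divided difference. -/
def divDiff {ℓ : ℕ} {W : Subgroup (GLC ℓ)} (al : W → Fin ℓ → ℂ) (s : W) (f : PolyR ℓ) : PolyR ℓ :=
  divOr0 (linForm (al s)) (f - polyAct s f)

/-- The properties of a reflection that are used below. -/
structure GoodRefl {ℓ : ℕ} {W : Subgroup (GLC ℓ)} (al : W → Fin ℓ → ℂ) (lam : W → ℂ) (s : W) :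
    Prop where
  ne : ∑ i, al s i * al s i ≠ 0
  lam_eq : lam s = -1
  act : ∀ i, polyAct s (X i) = X i - C (2 * al s i / ∑ k, al s k * al s k) * linForm (al s)

set_option maxHeartbeats 1000000 in
lemma goodRefl_of {ℓ : ℕ} {W : Subgroup (GLC ℓ)}
    (horth : ∀ g : W, (matOf g)ᵀ * matOf g = 1)
    (al cr : W → Fin ℓ → ℂ) (lam : W → ℂ) (s : W)
    (hlam : lam s ≠ 1)
    (heigx : Matrix.vecMul (al s) (matOf (s⁻¹ : W)) = lam s • al s)
    (hpair : ∑ i : Fin ℓ, al s i * cr s i = 2)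
    (hfix : ∀ v : Fin ℓ → ℂ,
      (∑ i : Fin ℓ, al s i * v i) = 0 → Matrix.mulVec (matOf s) v = v) :
    GoodRefl al lam s := by
  set a := al s with ha
  set M := matOf (s⁻¹ : W) with hM
  have hMs : M * matOf s = 1 := by
    simp only [hM, matOf, ← Units.val_mul, ← Subgroup.coe_mul]
    simp
  have hMt : Mᵀ * M = 1 := horth s⁻¹
  have hMt' : M * Mᵀ = 1 := mul_eq_one_comm.mp hMt
  have hst : matOf s = Mᵀ := by
    calc matOf s = (Mᵀ * M) * matOf s := by rw [hMt, one_mul]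
      _ = Mᵀ := by rw [mul_assoc, hMs, mul_one]
  have hane : a ≠ 0 := by
    intro h0
    rw [h0] at hpair
    simp at hpair
  have hsa : Matrix.mulVec (matOf s) a = lam s • a := by
    rw [hst, Matrix.mulVec_transpose, heigx]
  have hq : ∑ i, a i * a i ≠ 0 := by
    intro h0
    have h1 := hfix a h0
    rw [hsa] at h1
    apply hlam
    obtain ⟨i, hi⟩ := Function.ne_iff.mp hane
    have := congrFun h1 i
    simp only [Pi.smul_apply, smul_eq_mul] at this
    exact mul_right_cancel₀ hi (by rw [this, one_mul])
  have hMa : lam s • Matrix.mulVec M a = a := by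
    rw [← Matrix.mulVec_smul, ← hsa, Matrix.mulVec_mulVec, hMs, Matrix.one_mulVec]
  have hlam2 : lam s * lam s = 1 := by
    have h1 : (lam s • a) ⬝ᵥ (lam s • a) = a ⬝ᵥ a := by
      rw [← heigx]
      nth_rewrite 2 [← Matrix.mulVec_transpose]
      rw [← Matrix.dotProduct_mulVec, Matrix.mulVec_mulVec, hMt', Matrix.one_mulVec]
    have hq' : a ⬝ᵥ a ≠ 0 := hq
    rw [smul_dotProduct, dotProduct_smul, smul_eq_mul, smul_eq_mul, ← mul_assoc] at h1
    exact mul_right_cancel₀ hq' (by rw [h1, one_mul])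
  have hl : lam s = -1 := by
    rcases mul_self_eq_one_iff.mp hlam2 with h | h
    · exact absurd h hlam
    · exact h
  have hMa' : Matrix.mulVec M a = -a := by
    rw [hl, neg_smul, one_smul] at hMa
    exact neg_eq_iff_eq_neg.mp hMa
  have hMv : ∀ v, (∑ i, a i * v i) = 0 → Matrix.mulVec M v = v := by
    intro v hv
    conv_lhs => rw [← hfix v hv]
    rw [Matrix.mulVec_mulVec, hMs, Matrix.one_mulVec]
  set q := ∑ k, a k * a k with hqd
  have hMij : ∀ i j, M i j = (if i = j then 1 else 0) - 2 * a i / q * a j := by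
    intro i j
    have h1 := hMv (Pi.single j 1 - (a j / q) • a) (by
      simp only [Pi.sub_apply, Pi.smul_apply, smul_eq_mul, mul_sub, Finset.sum_sub_distrib]
      simp only [Pi.single_apply, mul_ite, mul_one, mul_zero, Finset.sum_ite_eq', Finset.mem_univ,
        if_true]
      have : ∑ x, a x * (a j / q * a x) = a j / q * q := by
        rw [hqd, Finset.mul_sum]; exact Finset.sum_congr rfl (fun x _ => by ring)
      rw [this]; field_simp; ring)
    rw [Matrix.mulVec_sub, Matrix.mulVec_smul, hMa'] at h1
    have h2 := congrFun h1 i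
    simp [Pi.single_apply] at h2
    rw [show M i j = _ from eq_sub_of_add_eq h2]
    ring
  refine ⟨hq, hl, fun i => ?_⟩
  simp only [polyAct, aeval_X, linForm, ← hM, hMij, Finset.mul_sum]
  simp only [C_sub, sub_mul, Finset.sum_sub_distrib]
  congr 1
  · simp
  · exact Finset.sum_congr rfl (fun x _ => by rw [C_mul, mul_assoc])

section refl
variable {ℓ : ℕ} {W : Subgroup (GLC ℓ)} {al : W → Fin ℓ → ℂ} {lam : W → ℂ} {s : W}

lemma GoodRefl.root_ne (h : GoodRefl al lam s) : linForm (al s) ≠ 0 := by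
  intro h0
  apply h.ne
  have := congrArg (MvPolynomial.eval (al s)) h0
  simpa [linForm] using this

lemma GoodRefl.dvd (h : GoodRefl al lam s) (f : PolyR ℓ) :
    linForm (al s) ∣ f - polyAct s f := by
  induction f using MvPolynomial.induction_on with
  | C a => simp [polyAct]
  | add p q hp hq =>
    rw [map_add, add_sub_add_comm]; exact dvd_add hp hq
  | mul_X p i hp =>
    have : p * X i - polyAct s (p * X i) =
        (p - polyAct s p) * X i + polyAct s p * (X i - polyAct s (X i)) := by
      rw [map_mul]; ring
    rw [this, h.act]
    refine dvd_add (hp.mul_right _) (Dvd.dvd.mul_left ?_ _)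
    rw [sub_sub_cancel]
    exact dvd_mul_left _ _

lemma GoodRefl.spec (h : GoodRefl al lam s) (f : PolyR ℓ) :
    linForm (al s) * divDiff al s f = f - polyAct s f := by
  unfold divDiff divOr0
  rw [dif_pos (h.dvd f)]
  exact (h.dvd f).choose_spec.symm

lemma GoodRefl.uniq (h : GoodRefl al lam s) {f g : PolyR ℓ}
    (hg : linForm (al s) * g = f - polyAct s f) : divDiff al s f = g :=
  mul_left_cancel₀ h.root_ne (by rw [h.spec, hg])

lemma GoodRefl.dd_add (h : GoodRefl al lam s) (f g : PolyR ℓ) :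
    divDiff al s (f + g) = divDiff al s f + divDiff al s g :=
  h.uniq (by rw [mul_add, h.spec, h.spec, map_add]; ring)

lemma GoodRefl.dd_smul (h : GoodRefl al lam s) (r : ℂ) (f : PolyR ℓ) :
    divDiff al s (r • f) = r • divDiff al s f :=
  h.uniq (by rw [mul_smul_comm, h.spec, map_smul, smul_sub])

lemma GoodRefl.dd_mul (h : GoodRefl al lam s) (f g : PolyR ℓ) :
    divDiff al s (f * g) = divDiff al s f * g + polyAct s f * divDiff al s g :=
  h.uniq (by rw [mul_add, ← mul_assoc, h.spec, mul_left_comm, h.spec, map_mul]; ring)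

lemma GoodRefl.dd_X (h : GoodRefl al lam s) (i : Fin ℓ) :
    divDiff al s (X i) = C (2 * al s i / ∑ k, al s k * al s k) :=
  h.uniq (by rw [h.act]; ring)

lemma GoodRefl.act_sq (h : GoodRefl al lam s) : polyAct s (sqSum ℓ) = sqSum ℓ := by
  unfold sqSum
  simp only [map_sum, map_pow, h.act]
  set q := ∑ k, al s k * al s k with hq
  have h1 : ∀ i, (X i - C (2 * al s i / q) * linForm (al s)) ^ 2 =
      (X i ^ 2 : PolyR ℓ) - C (4 / q) * linForm (al s) * (C (al s i) * X i)
        + C (4 / (q * q)) * linForm (al s) ^ 2 * C (al s i * al s i) := by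
    intro i
    have e1 : (C (2 * al s i / q) : PolyR ℓ) = C (2 / q) * C (al s i) := by
      rw [← C_mul]; congr 1; ring
    have e2 : (C (4 / q) : PolyR ℓ) = 2 * C (2 / q) := by
      rw [show (2 : PolyR ℓ) = C 2 from (map_ofNat C 2).symm, ← C_mul]; congr 1; ring
    have e3 : (C (4 / (q * q)) : PolyR ℓ) = C (2 / q) * C (2 / q) := by
      rw [← C_mul]; congr 1; rw [div_mul_div_comm]; norm_num
    rw [e1, e2, e3, C_mul]; ring
  simp only [h1, Finset.sum_add_distrib, Finset.sum_sub_distrib, ← Finset.mul_sum]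
  rw [← map_sum, ← hq, show ∑ i, C (al s i) * X i = linForm (al s) from rfl]
  have e : (C (4 / q) : PolyR ℓ) = C (4 / (q * q)) * C q := by
    rw [← C_mul]; congr 1; have := h.ne; field_simp
  rw [e]; ring

lemma GoodRefl.dd_sq (h : GoodRefl al lam s) : divDiff al s (sqSum ℓ) = 0 :=
  h.uniq (by rw [h.act_sq]; ring)

lemma eu_X (i : Fin ℓ) : eu ℓ (X i) = X i := by simp [eu, mkDerivation_X]

lemma eu_linForm (a : Fin ℓ → ℂ) : eu ℓ (linForm a) = linForm a := by
  simp [linForm, eu_X]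

lemma eu_polyAct (g : W) (f : PolyR ℓ) : eu ℓ (polyAct g f) = polyAct g (eu ℓ f) := by
  induction f using MvPolynomial.induction_on with
  | C a => simp [polyAct]
  | add p q hp hq => simp only [map_add, hp, hq]
  | mul_X p i hp =>
    have hX : eu ℓ (polyAct g (X i)) = polyAct g (X i) := by
      simp only [polyAct, aeval_X]; exact eu_linForm _
    simp only [map_mul, Derivation.leibniz, hp, hX, eu_X, smul_eq_mul, map_add]

lemma eu_pderiv (i : Fin ℓ) (f : PolyR ℓ) :
    eu ℓ (pderiv i f) = pderiv i (eu ℓ f) - pderiv i f := by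
  have : ⁅eu ℓ, pderiv i⁆ = - (pderiv i : Derivation ℂ (PolyR ℓ) (PolyR ℓ)) := by
    apply MvPolynomial.derivation_ext
    intro j
    simp only [Derivation.commutator_apply, eu_X, Derivation.neg_apply]
    simp [pderiv_X, Pi.single_apply]
    split_ifs <;> simp
  have h2 := congrArg (fun D => D f) this
  simp only [Derivation.commutator_apply, Derivation.neg_apply] at h2
  linear_combination h2

lemma eu_eq_sum (f : PolyR ℓ) : eu ℓ f = ∑ i, X i * pderiv i f := by
  induction f using MvPolynomial.induction_on with
  | C a => simp
  | add p q hp hq => simp only [map_add, hp, hq, mul_add, Finset.sum_add_distrib]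
  | mul_X p i hp =>
    simp only [Derivation.leibniz, hp, eu_X, smul_eq_mul, mul_add, Finset.sum_add_distrib]
    congr 1
    · simp [pderiv_X, Pi.single_apply]; ring
    · rw [Finset.mul_sum]; exact Finset.sum_congr rfl (fun x _ => by ring)

lemma GoodRefl.eu_dd (h : GoodRefl al lam s) (f : PolyR ℓ) :
    eu ℓ (divDiff al s f) = divDiff al s (eu ℓ f) - divDiff al s f := by
  rw [eq_sub_iff_add_eq]
  refine (h.uniq ?_).symm
  have h1 := congrArg (eu ℓ) (h.spec f)
  rw [Derivation.leibniz, eu_linForm, map_sub, eu_polyAct] at h1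
  simp only [smul_eq_mul] at h1
  rw [← h1]; ring

lemma eu_hom {m : ℕ} {f : PolyR ℓ} (hf : f.IsHomogeneous m) : eu ℓ f = (m : ℂ) • f := by
  rw [eu_eq_sum, hf.sum_X_mul_pderiv, Nat.cast_smul_eq_nsmul]

lemma comp_comm (T : PolyR ℓ →ₗ[ℂ] PolyR ℓ) (d e : ℕ)
    (hT : ∀ m f, f.IsHomogeneous m → homogeneousComponent d (T f) = if m = e then T f else 0)
    (f : PolyR ℓ) : homogeneousComponent d (T f) = T (homogeneousComponent e f) := by
  have h1 : (homogeneousComponent d).comp T = T.comp (homogeneousComponent e) := by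
    refine MvPolynomial.linearMap_ext (fun n => LinearMap.ext_ring ?_)
    have hm : (monomial n (1 : ℂ) : PolyR ℓ).IsHomogeneous n.degree :=
      isHomogeneous_monomial _ rfl
    simp only [LinearMap.comp_apply]
    rw [hT _ _ hm, homogeneousComponent_of_mem hm]
    by_cases h : n.degree = e
    · simp [h]
    · simp [h, Ne.symm h]
  exact congrArg (fun L => L f) h1

lemma comp_eu (d : ℕ) (f : PolyR ℓ) :
    homogeneousComponent d (eu ℓ f) = (d : ℂ) • homogeneousComponent d f := by
  rw [← eu_hom (homogeneousComponent_isHomogeneous d f)]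
  refine comp_comm (eu ℓ : PolyR ℓ →ₗ[ℂ] PolyR ℓ) d d (fun m f hf => ?_) f
  simp only [Derivation.coeFn_coe]
  rw [eu_hom hf, map_smul, homogeneousComponent_of_mem hf]
  by_cases h : m = d
  · simp [h]
  · simp [h, Ne.symm h]

lemma comp_eq_zero_of_eu {k : ℂ} {f : PolyR ℓ} (hf : eu ℓ f = k • f) {d : ℕ} (hd : (d : ℂ) ≠ k) :
    homogeneousComponent d f = 0 := by
  have h := comp_eu d f
  rw [hf, map_smul] at h
  have : ((d : ℂ) - k) • homogeneousComponent d f = 0 := by rw [sub_smul, h, sub_self]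
  exact (smul_eq_zero.mp this).resolve_left (sub_ne_zero.mpr hd)

lemma exists_nat_of_eu {k : ℂ} {f : PolyR ℓ} (hf : eu ℓ f = k • f) (h0 : f ≠ 0) :
    ∃ m : ℕ, k = m := by
  by_contra hk
  push Not at hk
  apply h0
  rw [← sum_homogeneousComponent f]
  exact Finset.sum_eq_zero (fun i _ => comp_eq_zero_of_eu hf (hk i).symm)

lemma hom_of_eu {m : ℕ} {f : PolyR ℓ} (hf : eu ℓ f = (m : ℂ) • f) : f.IsHomogeneous m := by
  rw [← sum_homogeneousComponent f]
  refine IsHomogeneous.sum _ _ _ (fun i _ => ?_)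
  by_cases h : i = m
  · subst h; exact homogeneousComponent_isHomogeneous _ _
  · rw [comp_eq_zero_of_eu hf (by exact_mod_cast h)]; exact isHomogeneous_zero _ _ _

lemma comp_polyAct (g : W) (d : ℕ) (f : PolyR ℓ) :
    homogeneousComponent d (polyAct g f) = polyAct g (homogeneousComponent d f) := by
  refine comp_comm (polyAct g).toLinearMap d d (fun m f hf => ?_) f
  simp only [AlgHom.toLinearMap_apply]
  have h1 : (polyAct g f).IsHomogeneous m := by
    apply hom_of_eu; rw [eu_polyAct, eu_hom hf, map_smul]
  rw [homogeneousComponent_of_mem h1]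
  simp only [eq_comm]

lemma polyAct_inv (g : W) (f : PolyR ℓ) : polyAct g (polyAct g⁻¹ f) = f := by
  have : (polyAct g).comp (polyAct g⁻¹) = AlgHom.id ℂ (PolyR ℓ) := by
    apply MvPolynomial.algHom_ext
    intro i
    simp only [AlgHom.comp_apply, polyAct, aeval_X, map_sum, map_mul, algHom_C, inv_inv,
      AlgHom.id_apply, algebraMap_eq]
    simp only [Finset.mul_sum]
    rw [Finset.sum_comm]
    have hM : matOf g * matOf g⁻¹ = 1 := by
      simp only [matOf, ← Units.val_mul, ← Subgroup.coe_mul]; simp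
    have h2 : ∀ y, ∑ x, (C (matOf g i x) * (C (matOf g⁻¹ x y) * X y) : PolyR ℓ) =
        C ((1 : Matrix (Fin ℓ) (Fin ℓ) ℂ) i y) * X y := by
      intro y
      rw [← hM, Matrix.mul_apply, map_sum, Finset.sum_mul]
      exact Finset.sum_congr rfl (fun x _ => by rw [C_mul, mul_assoc])
    simp only [h2, Matrix.one_apply]
    simp
  exact congrArg (fun φ => φ f) this

end refl

section dunkl
variable {ℓ : ℕ} {W : Subgroup (GLC ℓ)} {S : Finset W} {al : W → Fin ℓ → ℂ} {lam : W → ℂ}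
  (c : W → ℂ)

lemma dk_eq (hS : ∀ s ∈ S, GoodRefl al lam s) (y : Fin ℓ → ℂ) (f : PolyR ℓ) :
    dunklC S al lam c y f = (∑ i : Fin ℓ, y i • pderiv i f)
      - ∑ s ∈ S, (c s * ∑ i : Fin ℓ, al s i * y i) • divDiff al s f := by
  unfold dunklC
  congr 1
  refine Finset.sum_congr rfl (fun s hs => ?_)
  rw [(hS s hs).lam_eq, show 2 * c s / (1 - -1) = c s by ring]
  rfl

lemma dk_add (hS : ∀ s ∈ S, GoodRefl al lam s) (y : Fin ℓ → ℂ) (f g : PolyR ℓ) :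
    dunklC S al lam c y (f + g) = dunklC S al lam c y f + dunklC S al lam c y g := by
  simp only [dk_eq c hS, map_add, smul_add, Finset.sum_add_distrib]
  rw [Finset.sum_congr (s₁ := S) rfl (fun s hs => by rw [(hS s hs).dd_add, smul_add])]
  rw [Finset.sum_add_distrib]; ring

lemma dk_smul (hS : ∀ s ∈ S, GoodRefl al lam s) (y : Fin ℓ → ℂ) (r : ℂ) (f : PolyR ℓ) :
    dunklC S al lam c y (r • f) = r • dunklC S al lam c y f := by
  simp only [dk_eq c hS, smul_sub, Finset.smul_sum]
  congr 1
  · exact Finset.sum_congr rfl (fun i _ => by rw [Derivation.map_smul, smul_comm])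
  · exact Finset.sum_congr rfl (fun s hs => by rw [(hS s hs).dd_smul, smul_comm])

/-- The Dunkl operator as a linear map. -/
def dkL (hS : ∀ s ∈ S, GoodRefl al lam s) (y : Fin ℓ → ℂ) : PolyR ℓ →ₗ[ℂ] PolyR ℓ where
  toFun := dunklC S al lam c y
  map_add' := dk_add c hS y
  map_smul' := dk_smul c hS y

lemma dkL_eq (hS : ∀ s ∈ S, GoodRefl al lam s) (y : Fin ℓ → ℂ) (f : PolyR ℓ) :
    dkL c hS y f = (∑ i : Fin ℓ, y i • pderiv i f)
      - ∑ s ∈ S, (c s * ∑ i : Fin ℓ, al s i * y i) • divDiff al s f := dk_eq c hS y f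

lemma dkL_mul (hS : ∀ s ∈ S, GoodRefl al lam s) (y : Fin ℓ → ℂ) (f g : PolyR ℓ) :
    dkL c hS y (f * g) = dkL c hS y f * g + f * (∑ i : Fin ℓ, y i • pderiv i g)
      - ∑ s ∈ S, (c s * ∑ i : Fin ℓ, al s i * y i) • (polyAct s f * divDiff al s g) := by
  simp only [dkL_eq]
  rw [Finset.sum_congr (s₁ := S) rfl (fun s hs => by rw [(hS s hs).dd_mul, smul_add])]
  simp only [Derivation.leibniz, smul_eq_mul, smul_add, Finset.sum_add_distrib, sub_mul,
    Finset.sum_mul, Finset.mul_sum, smul_mul_assoc, mul_smul_comm]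
  have : ∑ x, y x • (g * pderiv x f) = ∑ x, y x • (pderiv x f * g) :=
    Finset.sum_congr rfl (fun x _ => by rw [mul_comm])
  rw [this]; ring

lemma eu_dkL (hS : ∀ s ∈ S, GoodRefl al lam s) (y : Fin ℓ → ℂ) {k : ℂ} {f : PolyR ℓ}
    (hf : eu ℓ f = k • f) : eu ℓ (dkL c hS y f) = (k - 1) • dkL c hS y f := by
  have h1 : eu ℓ (dkL c hS y f) = dkL c hS y (eu ℓ f) - dkL c hS y f := by
    simp only [dkL_eq, map_sub, map_sum, Derivation.map_smul, eu_pderiv]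
    rw [Finset.sum_congr (s₁ := S) rfl (fun s hs => by rw [(hS s hs).eu_dd])]
    simp only [smul_sub, Finset.sum_sub_distrib]
    ring
  rw [h1, hf, map_smul, sub_smul, one_smul]

lemma comp_dkL (hS : ∀ s ∈ S, GoodRefl al lam s) (y : Fin ℓ → ℂ) (d : ℕ) (f : PolyR ℓ) :
    homogeneousComponent d (dkL c hS y f) = dkL c hS y (homogeneousComponent (d + 1) f) := by
  refine comp_comm (dkL c hS y) d (d + 1) (fun m f hf => ?_) f
  have h1 := eu_dkL c hS y (eu_hom hf)
  split_ifs with h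
  · subst h
    apply homogeneousComponent_eq_self
    apply hom_of_eu
    rw [h1]; push_cast; ring_nf
  · apply comp_eq_zero_of_eu h1
    intro h2
    apply h
    have : ((d + 1 : ℕ) : ℂ) = m := by push_cast; rw [h2]; ring
    exact_mod_cast this.symm

/-- `Σ D_i²`. -/
def lapl (hS : ∀ s ∈ S, GoodRefl al lam s) : PolyR ℓ →ₗ[ℂ] PolyR ℓ :=
  ∑ i : Fin ℓ, (dkL c hS (Pi.single i 1)).comp (dkL c hS (Pi.single i 1))

lemma lapl_apply (hS : ∀ s ∈ S, GoodRefl al lam s) (f : PolyR ℓ) :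
    lapl c hS f = ∑ i : Fin ℓ, dkL c hS (Pi.single i 1) (dkL c hS (Pi.single i 1) f) := by
  simp [lapl]

lemma eu_lapl (hS : ∀ s ∈ S, GoodRefl al lam s) {k : ℂ} {f : PolyR ℓ}
    (hf : eu ℓ f = k • f) : eu ℓ (lapl c hS f) = (k - 2) • lapl c hS f := by
  rw [lapl_apply, map_sum, Finset.smul_sum]
  refine Finset.sum_congr rfl (fun i _ => ?_)
  rw [eu_dkL c hS _ (eu_dkL c hS _ hf)]
  congr 1; ring

lemma dkL_one (hS : ∀ s ∈ S, GoodRefl al lam s) (y : Fin ℓ → ℂ) : dkL c hS y 1 = 0 := by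
  rw [dkL_eq, Finset.sum_eq_zero, Finset.sum_eq_zero, sub_zero]
  · intro s hs
    rw [(hS s hs).uniq (f := 1) (g := 0) (by simp), smul_zero]
  · intro i _
    simp

lemma lapl_one (hS : ∀ s ∈ S, GoodRefl al lam s) : lapl c hS 1 = 0 := by
  rw [lapl_apply]
  simp [dkL_one]

lemma dkL_mul_sq (hS : ∀ s ∈ S, GoodRefl al lam s) (i : Fin ℓ) (f : PolyR ℓ) :
    dkL c hS (Pi.single i 1) (f * sqSum ℓ) =
      dkL c hS (Pi.single i 1) f * sqSum ℓ + (2 : ℂ) • (f * X i) := by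
  rw [dkL_mul]
  have h1 : ∑ s ∈ S, (c s * ∑ k : Fin ℓ, al s k * (Pi.single i 1 : Fin ℓ → ℂ) k) •
      (polyAct s f * divDiff al s (sqSum ℓ)) = 0 :=
    Finset.sum_eq_zero (fun s hs => by rw [(hS s hs).dd_sq, mul_zero, smul_zero])
  rw [h1, sub_zero]
  congr 1
  have h2 : ∑ k : Fin ℓ, (Pi.single i 1 : Fin ℓ → ℂ) k • pderiv k (sqSum ℓ) = (2 : ℂ) • X i := by
    rw [Finset.sum_eq_single i]
    · simp [sqSum, pderiv_X, Pi.single_apply, MvPolynomial.smul_eq_C_mul]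
      exact (map_ofNat C 2).symm
    · intro b _ hb; simp [hb]
    · simp
  rw [h2, mul_smul_comm]

lemma sum_X_dkL (hS : ∀ s ∈ S, GoodRefl al lam s) (f : PolyR ℓ) :
    ∑ i, dkL c hS (Pi.single i 1) f * X i = eu ℓ f - ∑ s ∈ S, c s • (f - polyAct s f) := by
  have h1 : ∀ i, dkL c hS (Pi.single i 1) f * X i = X i * pderiv i f -
      ∑ s ∈ S, c s • ((C (al s i) * X i) * divDiff al s f) := by
    intro i
    rw [dkL_eq, sub_mul, Finset.sum_mul, Finset.sum_mul]
    congr 1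
    · rw [Finset.sum_eq_single i]
      · simp [mul_comm]
      · intro b _ hb; simp [hb]
      · simp
    · refine Finset.sum_congr rfl (fun s _ => ?_)
      simp only [Pi.single_apply, mul_ite, mul_one, mul_zero, Finset.sum_ite_eq', Finset.mem_univ,
        if_true, MvPolynomial.smul_eq_C_mul, C_mul]
      ring
  simp only [h1, Finset.sum_sub_distrib]
  rw [← eu_eq_sum, Finset.sum_comm]
  congr 1
  refine Finset.sum_congr rfl (fun s hs => ?_)
  rw [← Finset.smul_sum, ← Finset.sum_mul, ← (hS s hs).spec]
  rfl

lemma sum_dkL_X (hS : ∀ s ∈ S, GoodRefl al lam s) (f : PolyR ℓ) :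
    ∑ i, dkL c hS (Pi.single i 1) (f * X i) =
      ∑ i, dkL c hS (Pi.single i 1) f * X i + (ℓ : ℂ) • f - ∑ s ∈ S, (2 * c s) • polyAct s f := by
  have h1 : ∀ i, dkL c hS (Pi.single i 1) (f * X i) = dkL c hS (Pi.single i 1) f * X i + f -
      ∑ s ∈ S, (2 * c s / (∑ k, al s k * al s k) * (al s i * al s i)) • polyAct s f := by
    intro i
    rw [dkL_mul]
    congr 1
    · congr 1
      rw [Finset.sum_eq_single i]
      · simp
      · intro b _ hb; simp [hb]
      · simp
    · refine Finset.sum_congr rfl (fun s hs => ?_)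
      rw [(hS s hs).dd_X, mul_comm (polyAct s f), ← MvPolynomial.smul_eq_C_mul, smul_smul]
      congr 1
      simp only [Pi.single_apply, mul_ite, mul_one, mul_zero, Finset.sum_ite_eq', Finset.mem_univ,
        if_true]
      ring
  simp only [h1, Finset.sum_sub_distrib, Finset.sum_add_distrib]
  congr 1
  · congr 1
    simp [Nat.cast_smul_eq_nsmul]
  · rw [Finset.sum_comm]
    refine Finset.sum_congr rfl (fun s hs => ?_)
    rw [← Finset.sum_smul, ← Finset.mul_sum, div_mul_cancel₀ _ (hS s hs).ne]

lemma lapl_mul_sq (hS : ∀ s ∈ S, GoodRefl al lam s) {k : ℂ} {f : PolyR ℓ}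
    (hf : eu ℓ f = k • f) :
    lapl c hS (f * sqSum ℓ) = lapl c hS f * sqSum ℓ
      + (4 * k + (2 * ℓ - 4 * ∑ s ∈ S, c s)) • f := by
  have h0 : lapl c hS (f * sqSum ℓ) = lapl c hS f * sqSum ℓ
      + (2 : ℂ) • ∑ i, dkL c hS (Pi.single i 1) f * X i
      + (2 : ℂ) • ∑ i, dkL c hS (Pi.single i 1) (f * X i) := by
    simp only [lapl_apply, dkL_mul_sq, map_add, map_smul, Finset.sum_add_distrib,
      Finset.sum_mul, Finset.smul_sum]
  rw [h0, sum_dkL_X, sum_X_dkL, hf]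
  simp only [smul_sub, Finset.sum_sub_distrib, ← Finset.smul_sum, mul_smul, add_smul, sub_smul,
    ← Finset.sum_smul]
  module

end dunkl

section sltwo
variable {ℓ : ℕ}

lemma sq_eu (n : ℕ) : eu ℓ (sqSum ℓ ^ n) = (2 * n : ℂ) • sqSum ℓ ^ n := by
  have h2 : (sqSum ℓ).IsHomogeneous 2 :=
    IsHomogeneous.sum _ _ _ (fun i _ => isHomogeneous_X_pow i 2)
  have := eu_hom (h2.pow n)
  rw [this]; push_cast; rfl

lemma F_sq_pow
    (F : PolyR ℓ →ₗ[ℂ] PolyR ℓ) (K : ℂ)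
    (hFE : ∀ (k : ℂ) f, eu ℓ f = k • f → F (f * sqSum ℓ) = F f * sqSum ℓ + (4 * k + K) • f)
    (hF1 : F 1 = 0)
    (n : ℕ) : F (sqSum ℓ ^ (n + 1)) = ((n + 1) * (K + 4 * n) : ℂ) • sqSum ℓ ^ n := by
  induction n with
  | zero =>
    have := hFE 0 1 (by simp)
    simpa [hF1] using this
  | succ n ih =>
    rw [pow_succ, hFE _ _ (sq_eu (n + 1)), ih, smul_mul_assoc, ← pow_succ, ← add_smul]
    congr 1
    push_cast; ring

lemma F_pow_eu
    (F : PolyR ℓ →ₗ[ℂ] PolyR ℓ)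
    (hF : ∀ (k : ℂ) f, eu ℓ f = k • f → eu ℓ (F f) = (k - 2) • F f)
    {k : ℂ} {f : PolyR ℓ} (hf : eu ℓ f = k • f) (j : ℕ) :
    eu ℓ ((F ^ j) f) = (k - 2 * j) • (F ^ j) f := by
  induction j with
  | zero => simpa using hf
  | succ j ih =>
    rw [pow_succ', Module.End.mul_apply, hF _ _ ih]
    congr 1; push_cast; ring

lemma F_pow_mem
    (F : PolyR ℓ →ₗ[ℂ] PolyR ℓ) (K : ℂ)
    (hFE : ∀ (k : ℂ) f, eu ℓ f = k • f → F (f * sqSum ℓ) = F f * sqSum ℓ + (4 * k + K) • f)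
    (hF : ∀ (k : ℂ) f, eu ℓ f = k • f → eu ℓ (F f) = (k - 2) • F f)
    (J : Ideal (PolyR ℓ)) (hJF : ∀ f ∈ J, F f ∈ J)
    {k : ℂ} {f : PolyR ℓ} (hf : eu ℓ f = k • f) (hfJ : f * sqSum ℓ ∈ J) (j : ℕ) :
    (F ^ (j + 1)) f * sqSum ℓ + ((j + 1) * (4 * k + K - 4 * j) : ℂ) • (F ^ j) f ∈ J := by
  induction j with
  | zero =>
    have h := hFE _ _ hf
    have h2 := hJF _ hfJ
    rw [h] at h2
    simpa using h2
  | succ j ih =>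
    have h := hFE _ _ (F_pow_eu F hF hf (j + 1))
    have h2 := hJF _ ih
    rw [map_add, h, map_smul, ← Module.End.mul_apply, ← Module.End.mul_apply, ← pow_succ',
      ← pow_succ', add_assoc, ← add_smul] at h2
    convert h2 using 3
    push_cast; ring

lemma F_top
    (F : PolyR ℓ →ₗ[ℂ] PolyR ℓ) (K : ℂ)
    (hFE : ∀ (k : ℂ) f, eu ℓ f = k • f → F (f * sqSum ℓ) = F f * sqSum ℓ + (4 * k + K) • f)
    (hF : ∀ (k : ℂ) f, eu ℓ f = k • f → eu ℓ (F f) = (k - 2) • F f)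
    (hF1 : F 1 = 0)
    (J : Ideal (PolyR ℓ)) (hJF : ∀ f ∈ J, F f ∈ J)
    (hJne : J ≠ ⊤) (d : ℕ) (htop : ∀ m, d < m → ∀ f : PolyR ℓ, f.IsHomogeneous m → f ∈ J)
    {f0 : PolyR ℓ} (hf0 : f0.IsHomogeneous d) (hf0J : f0 ∉ J) :
    ∃ n, d = 2 * n ∧ ∀ f : PolyR ℓ, f.IsHomogeneous d → f ∉ J → (F ^ n) f ∉ J := by
  have h2 : (sqSum ℓ).IsHomogeneous 2 :=
    IsHomogeneous.sum _ _ _ (fun i _ => isHomogeneous_X_pow i 2)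
  have hone : (1 : PolyR ℓ) ∉ J := fun h => hJne ((Ideal.eq_top_iff_one J).mpr h)
  -- the string through `1`
  have hex : ∃ n, sqSum ℓ ^ n ∈ J := ⟨d + 1, htop _ (by omega) _ (h2.pow _)⟩
  obtain ⟨n, hn, hn'⟩ : ∃ n, sqSum ℓ ^ n ∉ J ∧ sqSum ℓ ^ (n + 1) ∈ J := by
    have hs := Nat.find_spec hex
    have hmin := fun m => Nat.find_min hex (m := m)
    cases hN : Nat.find hex with
    | zero => rw [hN] at hs; exact absurd (by simpa using hs) hone
    | succ n => rw [hN] at hs hmin; exact ⟨n, hmin n (by omega), hs⟩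
  have hK : K = - 4 * n := by
    have h := hJF _ hn'
    rw [F_sq_pow F K hFE hF1] at h
    by_contra hne
    have hc : ((n + 1) * (K + 4 * n) : ℂ) ≠ 0 :=
      mul_ne_zero (by exact_mod_cast n.succ_ne_zero) (fun h0 => hne (by linear_combination h0))
    exact hn ((Submodule.smul_mem_iff (J.restrictScalars ℂ) hc).mp h)
  have hnd : 2 * n ≤ d := by
    by_contra hlt
    exact hn (htop _ (by omega) _ (h2.pow n))
  -- the string through `f`
  have key : ∀ f : PolyR ℓ, f.IsHomogeneous d → f ∉ J →
      ∃ j, j + n = d ∧ 2 * j ≤ d ∧ (F ^ j) f ∉ J := by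
    intro f hf hfJ
    have hfe := eu_hom hf
    have hz : ∀ j, (F ^ j) f ∉ J → 2 * j ≤ d := by
      intro j hj
      obtain ⟨m, hm⟩ := exists_nat_of_eu (F_pow_eu F hF hfe j)
        (fun h0 => hj (by rw [h0]; exact J.zero_mem))
      have : (d : ℂ) = ((m + 2 * j : ℕ) : ℂ) := by push_cast; linear_combination hm
      have : d = m + 2 * j := by exact_mod_cast this
      omega
    have hex : ∃ j, (F ^ j) f ∈ J := by
      refine ⟨d + 1, ?_⟩
      by_contra h
      have := hz _ h
      omega
    obtain ⟨j, hj, hj'⟩ : ∃ j, (F ^ j) f ∉ J ∧ (F ^ (j + 1)) f ∈ J := by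
      have hs := Nat.find_spec hex
      have hmin := fun m => Nat.find_min hex (m := m)
      cases hN : Nat.find hex with
      | zero => rw [hN] at hs; exact absurd (by simpa using hs) hfJ
      | succ n => rw [hN] at hs hmin; exact ⟨n, hmin n (by omega), hs⟩
    refine ⟨j, ?_, hz j hj, hj⟩
    have h := F_pow_mem F K hFE hF J hJF hfe (htop _ (by omega) _ (hf.mul h2)) j
    have h' : ((j + 1) * (4 * (d : ℂ) + K - 4 * j) : ℂ) • (F ^ j) f ∈ J :=
      (Ideal.add_mem_iff_right J (J.mul_mem_right _ hj')).mp h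
    by_contra hne
    have hc : ((j + 1) * (4 * (d : ℂ) + K - 4 * j) : ℂ) ≠ 0 := by
      refine mul_ne_zero (by exact_mod_cast j.succ_ne_zero) (fun h0 => hne ?_)
      rw [hK] at h0
      have : ((j + n : ℕ) : ℂ) = d := by push_cast; linear_combination (-1 / 4) * h0
      exact_mod_cast this
    exact hj ((Submodule.smul_mem_iff (J.restrictScalars ℂ) hc).mp h')
  obtain ⟨j0, e1, e2, -⟩ := key f0 hf0 hf0J
  refine ⟨n, by omega, fun f hf hfJ => ?_⟩
  obtain ⟨j, e3, e4, e5⟩ := key f hf hfJ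
  rwa [show n = j by omega]

end sltwo

/-- Let `W ⊆ GL(ℂ^ℓ)` be a finite group preserving an inner product (orthogonality), with
complex reflections `S` (roots `al`, coroots `cr`, eigenvalues `lam`, invariant parameters
`c`).  Let `J ⊆ ℂ[h]` be a graded (homogeneous) submodule of the polynomial representation of
`H_{1,c}(W)` — i.e. a homogeneous ideal stable under `W` and under the Dunkl operators — with
`A = ℂ[h]/J` finite dimensional.  If `A` is an irreducible `H_{1,c}`-module (there is no
`H_{1,c}`-stable ideal strictly between `J` and `ℂ[h]`), then `A` is a graded Frobenius
algebra: its top nonzero graded component `A[d]` is one-dimensional, and the multiplication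
pairing `A[m] × A[d-m] → A[d]` is nondegenerate. -/
theorem irreducible_quotient_is_frobenius {ℓ : ℕ} (W : Subgroup (GLC ℓ)) (hWfin : Finite W)
    (horth : ∀ g : W, (matOf g)ᵀ * matOf g = 1)
    (S : Finset W) (al cr : W → Fin ℓ → ℂ) (lam c : W → ℂ)
    (hlam : ∀ s ∈ S, lam s ≠ 1)
    (heigx : ∀ s ∈ S, Matrix.vecMul (al s) (matOf (s⁻¹ : W)) = lam s • al s)
    (heigy : ∀ s ∈ S, Matrix.mulVec (matOf s) (cr s) = (lam s)⁻¹ • cr s)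
    (hpair : ∀ s ∈ S, ∑ i : Fin ℓ, al s i * cr s i = 2)
    (hfix : ∀ s ∈ S, ∀ v : Fin ℓ → ℂ,
      (∑ i : Fin ℓ, al s i * v i) = 0 → Matrix.mulVec (matOf s) v = v)
    (hrefl : ∀ g : W, ((matOf g) - 1).rank ≤ 1 → (g ∈ S ∨ g = 1))
    (hconj : ∀ g : W, ∀ s ∈ S,
      g * s * g⁻¹ ∈ S ∧ c (g * s * g⁻¹) = c s ∧ lam (g * s * g⁻¹) = lam s)
    (J : Ideal (MvPolynomial (Fin ℓ) ℂ)) (hJne : J ≠ ⊤)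
    (hJhom : ∀ f ∈ J, ∀ m : ℕ, homogeneousComponent m f ∈ J)
    (hJW : ∀ f ∈ J, ∀ g : W, polyAct g f ∈ J)
    (hJD : ∀ f ∈ J, ∀ y : Fin ℓ → ℂ, dunklC S al lam c y f ∈ J)
    (hfd : FiniteDimensional ℂ (MvPolynomial (Fin ℓ) ℂ ⧸ J))
    (hirr : ∀ J' : Ideal (MvPolynomial (Fin ℓ) ℂ), J ≤ J' →
      (∀ f ∈ J', ∀ g : W, polyAct g f ∈ J') →
      (∀ f ∈ J', ∀ y : Fin ℓ → ℂ, dunklC S al lam c y f ∈ J') →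
      J' = J ∨ J' = ⊤)
    (Am : ℕ → Submodule ℂ (MvPolynomial (Fin ℓ) ℂ ⧸ J))
    (hAm : ∀ m, Am m = Submodule.map (Ideal.Quotient.mkₐ ℂ J).toLinearMap
      (homogeneousSubmodule (Fin ℓ) ℂ m))
    (d : ℕ) (hd : Am d ≠ ⊥) (htop : ∀ m, d < m → Am m = ⊥) :
    Module.finrank ℂ (Am d) = 1 ∧
    ∀ m, m ≤ d → ∀ a ∈ Am m, a ≠ 0 → ∃ b ∈ Am (d - m), a * b ≠ 0 := by
  have hS : ∀ s ∈ S, GoodRefl al lam s := fun s hs =>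
    goodRefl_of horth al cr lam s (hlam s hs) (heigx s hs) (hpair s hs) (hfix s hs)
  have hJD' : ∀ f ∈ J, ∀ y, dkL c hS y f ∈ J := hJD
  have hmk : ∀ f : PolyR ℓ, Ideal.Quotient.mk J f = 0 ↔ f ∈ J := fun f =>
    Ideal.Quotient.eq_zero_iff_mem
  have hmem : ∀ m a, a ∈ Am m ↔ ∃ f : PolyR ℓ, f.IsHomogeneous m ∧ Ideal.Quotient.mk J f = a := by
    intro m a
    rw [hAm m]
    simp [Submodule.mem_map, mem_homogeneousSubmodule]
  have htop' : ∀ m, d < m → ∀ f : PolyR ℓ, f.IsHomogeneous m → f ∈ J := by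
    intro m hm f hf
    have h1 : Ideal.Quotient.mk J f ∈ Am m := (hmem _ _).mpr ⟨f, hf, rfl⟩
    rw [htop m hm, Submodule.mem_bot] at h1
    exact (hmk f).mp h1
  obtain ⟨f0, hf0, hf0J⟩ : ∃ f0 : PolyR ℓ, f0.IsHomogeneous d ∧ f0 ∉ J := by
    obtain ⟨a, ha, ha0⟩ := Submodule.exists_mem_ne_zero_of_ne_bot hd
    obtain ⟨f, hf, rfl⟩ := (hmem _ _).mp ha
    exact ⟨f, hf, fun h => ha0 ((hmk f).mpr h)⟩
  constructor
  · obtain ⟨n, hn, hinj⟩ := F_top (lapl c hS) (2 * ℓ - 4 * ∑ s ∈ S, c s)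
      (fun k f hf => lapl_mul_sq c hS hf) (fun k f hf => eu_lapl c hS hf) (lapl_one c hS) J
      (fun f hf => by
        rw [lapl_apply]
        exact J.sum_mem (fun i _ => hJD' _ (hJD' _ hf _) _)) hJne d htop' hf0 hf0J
    have hconst : ∀ f : PolyR ℓ, f.IsHomogeneous d → ∃ r : ℂ, (lapl c hS ^ n) f = C r := by
      intro f hf
      have h1 := F_pow_eu (lapl c hS) (fun k f hf => eu_lapl c hS hf) (eu_hom hf) n
      have h2 : ((lapl c hS ^ n) f).IsHomogeneous 0 := by
        apply hom_of_eu
        rw [h1, hn]; push_cast; simp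
      rw [← totalDegree_zero_iff_isHomogeneous, totalDegree_eq_zero_iff_eq_C] at h2
      exact ⟨_, h2⟩
    obtain ⟨r0, hr0⟩ := hconst f0 hf0
    have hr0' : r0 ≠ 0 := by
      intro h
      apply hinj f0 hf0 hf0J
      rw [hr0, h, C_0]; exact J.zero_mem
    have hv : Ideal.Quotient.mk J f0 ∈ Am d := (hmem _ _).mpr ⟨f0, hf0, rfl⟩
    refine finrank_eq_one (⟨_, hv⟩ : Am d) (fun h => hf0J ((hmk f0).mp (congrArg Subtype.val h))) ?_
    rintro ⟨w, hw⟩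
    obtain ⟨f, hf, rfl⟩ := (hmem _ _).mp hw
    obtain ⟨r, hr⟩ := hconst f hf
    refine ⟨r / r0, Subtype.ext ?_⟩
    have hg : (f - (r / r0) • f0) ∈ J := by
      by_contra hg
      apply hinj _ (hf.sub ((homogeneousSubmodule (Fin ℓ) ℂ d).smul_mem _ hf0)) hg
      rw [map_sub, map_smul, hr, hr0, MvPolynomial.smul_eq_C_mul, ← C_mul,
        div_mul_cancel₀ _ hr0', sub_self]
      exact J.zero_mem
    have hg' := (hmk _).mpr hg
    rw [map_sub, sub_eq_zero] at hg'
    exact hg'.symm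
  · -- the radical of the pairing
    let N : Ideal (PolyR ℓ) :=
      { carrier := {f | ∀ g, homogeneousComponent d (f * g) ∈ J}
        zero_mem' := fun g => by simp
        add_mem' := fun {a b} ha hb g => by
          rw [add_mul, map_add]; exact J.add_mem (ha g) (hb g)
        smul_mem' := fun r f hf g => by
          rw [smul_eq_mul, mul_comm r f, mul_assoc]; exact hf _ }
    have hN : ∀ f, f ∈ N ↔ ∀ g, homogeneousComponent d (f * g) ∈ J := fun f => Iff.rfl
    have hJN : J ≤ N := fun f hf g => hJhom _ (J.mul_mem_right g hf) d
    have hNW : ∀ f ∈ N, ∀ g : W, polyAct g f ∈ N := by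
      intro f hf g h
      have : polyAct g f * h = polyAct g (f * polyAct g⁻¹ h) := by
        rw [map_mul, polyAct_inv]
      rw [this, comp_polyAct]
      exact hJW _ (hf _) g
    have hND : ∀ f ∈ N, ∀ y : Fin ℓ → ℂ, dunklC S al lam c y f ∈ N := by
      intro f hf y g
      have h1 := dkL_mul c hS y f g
      have h2 : dunklC S al lam c y f * g = dkL c hS y (f * g)
          - f * (∑ i : Fin ℓ, y i • pderiv i g)
          + ∑ s ∈ S, (c s * ∑ i : Fin ℓ, al s i * y i) • (polyAct s f * divDiff al s g) := by
        rw [h1]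
        change dkL c hS y f * g = _
        ring
      rw [h2, map_add, map_sub, map_sum, comp_dkL]
      refine J.add_mem (J.sub_mem ?_ (hf _)) (J.sum_mem (fun s hs => ?_))
      · exact hJD' _ (htop' (d + 1) (by omega) _ (homogeneousComponent_isHomogeneous _ _)) _
      · rw [map_smul]
        exact (J.restrictScalars ℂ).smul_mem _ (hNW f hf s _)
    have hNJ : N = J := by
      refine (hirr N hJN hNW hND).resolve_right (fun h => hf0J ?_)
      have h1 : (1 : PolyR ℓ) ∈ N := by rw [h]; trivial
      have h2 := h1 f0
      rwa [one_mul, homogeneousComponent_eq_self hf0] at h2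
    intro m hm a ha ha0
    obtain ⟨f, hf, rfl⟩ := (hmem _ _).mp ha
    have hfN : f ∉ N := by rw [hNJ]; exact fun h => ha0 ((hmk f).mpr h)
    rw [hN] at hfN
    push Not at hfN
    obtain ⟨g, hg⟩ := hfN
    refine ⟨Ideal.Quotient.mk J (homogeneousComponent (d - m) g),
      (hmem _ _).mpr ⟨_, homogeneousComponent_isHomogeneous _ _, rfl⟩, ?_⟩
    rw [← map_mul]
    intro h0
    apply hg
    have hcm := comp_comm (LinearMap.mulLeft ℂ f) d (d - m) (fun k g hg => ?_) g
    · simp only [LinearMap.mulLeft_apply] at hcm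
      rw [hcm]
      exact (hmk _).mp h0
    · simp only [LinearMap.mulLeft_apply]
      rw [homogeneousComponent_of_mem (hf.mul hg)]
      congr 1
      rw [eq_iff_iff]
      omega

end
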